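/- For every integer base q > 2 and every nonnegative integer m, the minimal q-Niven number with digit-sum parameter k = q^m is a_{q^m} = q^m · (2·q^{(q^m − 1)/(q − 1)} − 1). For q = 2 and every nonnegative integer m, a_{2^m} = 2^m · (2^{2^m} − 1). -/

import Mathlib

/-- `digSum q n` is the sum of the digits of `n` written in base `q`. -/
def digSum (q n : ℕ) : ℕ := (Nat.digits q n).sum

/-- `akq q k` is the smallest positive multiple of `k` whose base-`q` digit sum
equals `k` (the minimal `q`-Niven number with digit sum `k`). -/
noncomputable def akq (q k : ℕ) : ℕ :=
  sInf {N : ℕ | 0 < N ∧ k ∣ N ∧ digSum q N = k}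

lemma digSum_add_mul {q d : ℕ} (hq : 1 < q) (hd : d < q) (n : ℕ) :
    digSum q (d + q * n) = d + digSum q n := by
  unfold digSum
  by_cases h : d ≠ 0 ∨ n ≠ 0
  · rw [Nat.digits_add q hq d n hd h, List.sum_cons]
  · push Not at h
    simp [h.1, h.2]

lemma digSum_pow_mul {q : ℕ} (hq : 1 < q) (m n : ℕ) :
    digSum q (q ^ m * n) = digSum q n := by
  induction m with
  | zero => simp
  | succ m ih =>
    have h := digSum_add_mul hq (by omega : 0 < q) (q ^ m * n)
    rw [zero_add, zero_add, ih] at h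
    rw [pow_succ', mul_assoc, h]

/-- A number with digit sum at least `L * (q - 1) + r` is at least `(r + 1) * q ^ L - 1`. -/
lemma succ_mul_pow_le_of_le_digSum {q : ℕ} (hq : 1 < q) (L r n : ℕ)
    (h : L * (q - 1) + r ≤ digSum q n) : (r + 1) * q ^ L ≤ n + 1 := by
  induction L generalizing r n with
  | zero =>
    have := Nat.digit_sum_le q n
    unfold digSum at h
    simp only [pow_zero, mul_one]
    omega
  | succ L ih =>
    have hd : n % q < q := Nat.mod_lt _ (by omega)
    have hn : n % q + q * (n / q) = n := Nat.mod_add_div n q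
    have hs := digSum_add_mul hq hd (n / q)
    rw [hn] at hs
    obtain ⟨e, he⟩ : ∃ e, n % q + e + 1 = q := ⟨q - 1 - n % q, by omega⟩
    have key := ih (r + e) (n / q) (by rw [Nat.succ_mul] at h; omega)
    have hpos : 1 ≤ q ^ (L + 1) := Nat.one_le_pow _ _ (by omega)
    have h1 : (r + e + 1) * q ^ (L + 1) ≤ q * (n / q) + q := by
      calc (r + e + 1) * q ^ (L + 1) = q * ((r + e + 1) * q ^ L) := by ring
        _ ≤ q * (n / q + 1) := Nat.mul_le_mul_left q key
        _ = q * (n / q) + q := by ring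
    have h2 : (r + 1) * q ^ (L + 1) + e ≤ (r + e + 1) * q ^ (L + 1) := by nlinarith
    omega

lemma digSum_succ_mul_pow_sub_one {q : ℕ} (hq : 1 < q) {r : ℕ} (hr : r < q) (L : ℕ) :
    digSum q ((r + 1) * q ^ L - 1) = L * (q - 1) + r := by
  induction L with
  | zero => simpa [digSum] using digSum_add_mul hq hr 0
  | succ L ih =>
    have hpos : 1 ≤ (r + 1) * q ^ L := Nat.mul_pos (by omega) (Nat.pow_pos (by omega))
    have h : (r + 1) * q ^ (L + 1) - 1 = (q - 1) + q * ((r + 1) * q ^ L - 1) := by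
      obtain ⟨a, ha⟩ := Nat.exists_eq_add_of_le hpos
      have : (r + 1) * q ^ (L + 1) = q * a + q := by
        calc (r + 1) * q ^ (L + 1) = q * ((r + 1) * q ^ L) := by ring
          _ = q * a + q := by rw [ha]; ring
      rw [this, ha, Nat.add_sub_cancel_left]
      omega
    rw [h, digSum_add_mul hq (by omega), ih, Nat.succ_mul]
    omega

lemma akq_pow_eq {q : ℕ} (hq : 1 < q) {r L m : ℕ} (hr : r < q)
    (h : L * (q - 1) + r = q ^ m) :
    akq q (q ^ m) = q ^ m * ((r + 1) * q ^ L - 1) := by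
  have hqm : 0 < q ^ m := Nat.pow_pos (by omega)
  refine IsLeast.csInf_eq ⟨⟨?_, Dvd.intro _ rfl, ?_⟩, ?_⟩
  · refine Nat.mul_pos hqm (Nat.pos_of_ne_zero fun h0 => ?_)
    have := digSum_succ_mul_pow_sub_one hq hr L
    rw [h0, h] at this
    simp [digSum] at this
    omega
  · rw [digSum_pow_mul hq, digSum_succ_mul_pow_sub_one hq hr, h]
  · rintro _ ⟨-, ⟨n, rfl⟩, hn⟩
    rw [digSum_pow_mul hq] at hn
    have := succ_mul_pow_le_of_le_digSum hq L r n (by omega)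
    exact Nat.mul_le_mul_left _ (by omega)

/-- Lemma 18 of the paper: for `q > 2`, the minimal `q`-Niven number with
digit-sum parameter `k = q^m` is `a_(q^m) = q^m (2 q^((q^m-1)/(q-1)) - 1)`, and
for `q = 2` it is `a_(2^m) = 2^m (2^(2^m) - 1)`. -/
theorem akq_prime_power_of_base :
    (∀ q m : ℕ, 2 < q →
      akq q (q ^ m) = q ^ m * (2 * q ^ ((q ^ m - 1) / (q - 1)) - 1)) ∧
    (∀ m : ℕ, akq 2 (2 ^ m) = 2 ^ m * (2 ^ (2 ^ m) - 1)) := by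
  refine ⟨fun q m hq => ?_, fun m => ?_⟩
  · refine akq_pow_eq (r := 1) (by omega) (by omega) ?_
    rw [Nat.div_mul_cancel (by simpa using Nat.sub_dvd_pow_sub_pow q 1 m)]
    exact Nat.sub_add_cancel (Nat.one_le_pow _ _ (by omega))
  · simpa using akq_pow_eq (q := 2) (r := 0) (L := 2 ^ m) (m := m) (by omega) (by omega) (by simp)
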